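/- arXiv:1608.01563 — 2 statements merged into one kernel-verified Lean document; each statement's English description precedes it below -/
import Mathlib

section
/- For all integers n ≥ b ≥ 2, the number of (n,b)-domino towers T satisfying the additional conditions that (−1,1) ∈ T (a level-1 domino overhangs the base on the left) and (2b−1,1) ∈ T (a level-1 domino extends one unit past the base on the right) equals C(2n−3, n−b−2), with the convention C(m, j) = 0 for j < 0. -/
/-- `T` is an (n,b)-domino tower: a finite set of pairs `(x, y)` where `(x, y) ∈ T` means a
horizontal 1×2 domino occupies columns `x` and `x+1` at level `y`. -/
def IsDominoTower (n b : ℕ) (T : Finset (ℤ × ℕ)) : Prop :=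
  T.card = n ∧
  (∀ x : ℤ, (x, 0) ∈ T ↔ ∃ i : ℕ, i < b ∧ x = 2 * (i : ℤ)) ∧
  (∀ x x' : ℤ, ∀ y : ℕ, (x, y) ∈ T → (x', y) ∈ T → x ≠ x' → 2 ≤ |x - x'|) ∧
  (∀ x : ℤ, ∀ y : ℕ, (x, y + 1) ∈ T → ∃ x' : ℤ, (x', y) ∈ T ∧ |x - x'| ≤ 1)

/-- The binomial coefficient `C(m, j)` with an integer lower index, extended by the convention
that it is `0` whenever `j < 0` (and, via `Nat.choose`, whenever `j > m`). -/
def binom (m : ℕ) (j : ℤ) : ℕ := if 0 ≤ j then m.choose j.toNat else 0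

namespace DT

noncomputable def nb (S : Finset ℤ) : Finset ℤ := S.biUnion (fun x => Finset.Icc (x-1) (x+1))

def row0 (T : Finset (ℤ × ℕ)) : Finset ℤ := (T.filter (fun p => p.2 = 0)).image Prod.fst

def up (T : Finset (ℤ × ℕ)) : Finset (ℤ × ℕ) :=
  (T.filter (fun p => p.2 ≠ 0)).image (fun p => (p.1, p.2 - 1))

def build (S : Finset ℤ) (T : Finset (ℤ × ℕ)) : Finset (ℤ × ℕ) :=
  S.image (fun x => (x, 0)) ∪ T.image (fun p => (p.1, p.2 + 1))

def Ind (S : Finset ℤ) : Prop := ∀ x ∈ S, ∀ y ∈ S, x ≠ y → 2 ≤ |x - y|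

instance (S : Finset ℤ) : Decidable (Ind S) := by unfold Ind; infer_instance

def Tow (T : Finset (ℤ × ℕ)) : Prop :=
  (∀ x x' : ℤ, ∀ y : ℕ, (x, y) ∈ T → (x', y) ∈ T → x ≠ x' → 2 ≤ |x - x'|) ∧
  (∀ x : ℤ, ∀ y : ℕ, (x, y + 1) ∈ T → ∃ x' : ℤ, (x', y) ∈ T ∧ |x - x'| ≤ 1)

noncomputable def cnt (m : ℤ) (M : Finset ℤ) : ℕ :=
  Nat.card {T : Finset (ℤ × ℕ) // (T.card : ℤ) = m ∧ Tow T ∧ row0 T ⊆ M}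

lemma mem_nb {S : Finset ℤ} {x : ℤ} : x ∈ nb S ↔ ∃ y ∈ S, |x - y| ≤ 1 := by
  simp only [nb, Finset.mem_biUnion, Finset.mem_Icc, abs_le]
  constructor
  · rintro ⟨y, h, h1, h2⟩; exact ⟨y, h, by omega, by omega⟩
  · rintro ⟨y, h, h1, h2⟩; exact ⟨y, h, by omega, by omega⟩

lemma mem_row0 {T : Finset (ℤ × ℕ)} {x : ℤ} : x ∈ row0 T ↔ (x, 0) ∈ T := by
  simp [row0]

lemma mem_up {T : Finset (ℤ × ℕ)} {x : ℤ} {y : ℕ} : (x, y) ∈ up T ↔ (x, y + 1) ∈ T := by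
  simp only [up, Finset.mem_image, Finset.mem_filter, Prod.exists, Prod.mk.injEq]
  constructor
  · rintro ⟨a, c, ⟨h, h0⟩, rfl, rfl⟩
    obtain ⟨c, rfl⟩ := Nat.exists_eq_succ_of_ne_zero h0
    simpa using h
  · intro h; exact ⟨x, y + 1, ⟨h, by simp⟩, rfl, by simp⟩

lemma mem_build_zero {S : Finset ℤ} {T : Finset (ℤ × ℕ)} {x : ℤ} :
    (x, 0) ∈ build S T ↔ x ∈ S := by
  simp [build]

lemma mem_build_succ {S : Finset ℤ} {T : Finset (ℤ × ℕ)} {x : ℤ} {y : ℕ} :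
    (x, y + 1) ∈ build S T ↔ (x, y) ∈ T := by
  simp [build]

lemma card_build (S : Finset ℤ) (T : Finset (ℤ × ℕ)) : (build S T).card = S.card + T.card := by
  unfold build
  rw [Finset.card_union_of_disjoint, Finset.card_image_of_injective, Finset.card_image_of_injective]
  · rintro ⟨a, b⟩ ⟨c, d⟩ h; simpa using h
  · intro a b h; simpa using h
  · rw [Finset.disjoint_left]
    simp

lemma up_build (S : Finset ℤ) (T : Finset (ℤ × ℕ)) : up (build S T) = T := by
  ext ⟨x, y⟩; rw [mem_up, mem_build_succ]

lemma row0_build (S : Finset ℤ) (T : Finset (ℤ × ℕ)) : row0 (build S T) = S := by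
  ext x; rw [mem_row0, mem_build_zero]

lemma build_up (T : Finset (ℤ × ℕ)) : build (row0 T) (up T) = T := by
  ext ⟨x, y⟩
  cases y with
  | zero => rw [mem_build_zero, mem_row0]
  | succ y => rw [mem_build_succ, mem_up]

lemma tow_build {S : Finset ℤ} {T : Finset (ℤ × ℕ)} :
    Tow (build S T) ↔ Ind S ∧ Tow T ∧ row0 T ⊆ nb S := by
  constructor
  · rintro ⟨h1, h2⟩
    refine ⟨fun x hx y hy hxy => h1 x y 0 (mem_build_zero.2 hx) (mem_build_zero.2 hy) hxy,
      ⟨fun x x' y hx hy => h1 x x' (y+1) (mem_build_succ.2 hx) (mem_build_succ.2 hy),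
       fun x y hx => ?_⟩, fun x hx => ?_⟩
    · obtain ⟨x', h, h'⟩ := h2 x (y+1) (mem_build_succ.2 hx)
      exact ⟨x', mem_build_succ.1 h, h'⟩
    · obtain ⟨x', h, h'⟩ := h2 x 0 (mem_build_succ.2 (mem_row0.1 hx))
      exact mem_nb.2 ⟨x', mem_build_zero.1 h, h'⟩
  · rintro ⟨hI, ⟨h1, h2⟩, h3⟩
    constructor
    · intro x x' y hx hy hxy
      cases y with
      | zero => exact hI x (mem_build_zero.1 hx) x' (mem_build_zero.1 hy) hxy
      | succ y => exact h1 x x' y (mem_build_succ.1 hx) (mem_build_succ.1 hy) hxy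
    · intro x y hx
      rw [mem_build_succ] at hx
      cases y with
      | zero =>
        obtain ⟨z, hz, hz'⟩ := mem_nb.1 (h3 (mem_row0.2 hx))
        exact ⟨z, mem_build_zero.2 hz, hz'⟩
      | succ y =>
        obtain ⟨z, hz, hz'⟩ := h2 x y hx
        exact ⟨z, mem_build_succ.2 hz, hz'⟩

/-- Peel off the bottom row. -/
def peel (m : ℤ) (S : Finset ℤ) (hS : Ind S) (p : Finset (ℤ × ℕ) → Prop) :
    {T : Finset (ℤ × ℕ) // (T.card : ℤ) = m ∧ Tow T ∧ row0 T = S ∧ p (up T)} ≃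
    {T : Finset (ℤ × ℕ) // (T.card : ℤ) = m - S.card ∧ Tow T ∧ row0 T ⊆ nb S ∧ p T} where
  toFun T := ⟨up T.1, by
    obtain ⟨T, h1, h2, h3, h4⟩ := T
    have hb : build S (up T) = T := by rw [← h3, build_up]
    have hc := card_build S (up T)
    rw [hb] at hc
    rw [← hb, tow_build] at h2
    exact ⟨by dsimp only; omega, h2.2.1, h2.2.2, h4⟩⟩
  invFun T := ⟨build S T.1, by
    obtain ⟨T, h1, h2, h3, h4⟩ := T
    have hc := card_build S T
    exact ⟨by dsimp only; omega, tow_build.2 ⟨hS, h2, h3⟩, row0_build _ _, by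
      dsimp only; rw [up_build]; exact h4⟩⟩
  left_inv T := by
    obtain ⟨T, h1, h2, h3, h4⟩ := T
    apply Subtype.ext
    dsimp only
    rw [← h3, build_up]
  right_inv T := by
    apply Subtype.ext
    exact up_build _ _

lemma ind_row0 {T : Finset (ℤ × ℕ)} (h : Tow T) : Ind (row0 T) := fun x hx y hy =>
  h.1 x y 0 (mem_row0.1 hx) (mem_row0.1 hy)

lemma eq_empty_of_row0 {T : Finset (ℤ × ℕ)} (h : Tow T) (h0 : row0 T ⊆ ∅) : T = ∅ := by
  have : ∀ y x, (x, y) ∉ T := by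
    intro y
    induction y with
    | zero => intro x hx; exact absurd (h0 (mem_row0.2 hx)) (by simp)
    | succ y ih => intro x hx; obtain ⟨z, hz, _⟩ := h.2 x y hx; exact ih z hz
  ext ⟨x, y⟩; simp [this]

lemma tow_empty : Tow ∅ := ⟨by simp, by simp⟩

def split (m : ℤ) (F : Finset (Finset ℤ)) :
    {T : Finset (ℤ × ℕ) // (T.card : ℤ) = m ∧ Tow T ∧ row0 T ∈ F} ≃
    Σ S : F, {T : Finset (ℤ × ℕ) // (T.card : ℤ) = m ∧ Tow T ∧ row0 T = S.1 ∧ True} where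
  toFun T := ⟨⟨row0 T.1, T.2.2.2⟩, ⟨T.1, T.2.1, T.2.2.1, rfl, trivial⟩⟩
  invFun X := ⟨X.2.1, X.2.2.1, X.2.2.2.1, by rw [X.2.2.2.2.1]; exact X.1.2⟩
  left_inv T := rfl
  right_inv X := by
    obtain ⟨⟨S, hS⟩, ⟨T, h1, h2, h3, h4⟩⟩ := X
    dsimp only at h3
    subst h3
    rfl

def ind (M : Finset ℤ) : Finset (Finset ℤ) := M.powerset.filter Ind

lemma mem_ind {M S : Finset ℤ} : S ∈ ind M ↔ S ⊆ M ∧ Ind S := by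
  simp [ind]

def toIn (m : ℤ) (M : Finset ℤ) :
    {T : Finset (ℤ × ℕ) // (T.card : ℤ) = m ∧ Tow T ∧ row0 T ⊆ M} ≃
    {T : Finset (ℤ × ℕ) // (T.card : ℤ) = m ∧ Tow T ∧ row0 T ∈ ind M} :=
  Equiv.subtypeEquivRight (fun T => by
    constructor
    · rintro ⟨h1, h2, h3⟩; exact ⟨h1, h2, mem_ind.2 ⟨h3, ind_row0 h2⟩⟩
    · rintro ⟨h1, h2, h3⟩; exact ⟨h1, h2, (mem_ind.1 h3).1⟩)

lemma fin (k : ℕ) : ∀ (m : ℤ) (M : Finset ℤ), m < k →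
    Finite {T : Finset (ℤ × ℕ) // (T.card : ℤ) = m ∧ Tow T ∧ row0 T ⊆ M} := by
  induction k with
  | zero =>
    intro m M hm
    have : IsEmpty {T : Finset (ℤ × ℕ) // (T.card : ℤ) = m ∧ Tow T ∧ row0 T ⊆ M} :=
      ⟨fun T => by have := T.2.1; push_cast at hm; omega⟩
    infer_instance
  | succ k ih =>
    intro m M hm
    have : ∀ S : ind M, Finite
      {T : Finset (ℤ × ℕ) // (T.card : ℤ) = m ∧ Tow T ∧ row0 T = S.1 ∧ True} := by
      rintro ⟨S, hS⟩
      have hI := (mem_ind.1 hS).2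
      rcases S.eq_empty_or_nonempty with rfl | hne
      · have : Subsingleton {T : Finset (ℤ × ℕ) // (T.card : ℤ) = m ∧ Tow T ∧ row0 T = ∅ ∧ True} := by
          constructor
          rintro ⟨T, _, h, h', _⟩ ⟨T', _, g, g', _⟩
          apply Subtype.ext
          dsimp only
          rw [eq_empty_of_row0 h h'.subset, eq_empty_of_row0 g g'.subset]
        infer_instance
      · have hc := hne.card_pos
        have := ih (m - S.card) (nb S) (by push_cast at hm; omega)
        have e : {T : Finset (ℤ × ℕ) // (T.card : ℤ) = m - S.card ∧ Tow T ∧ row0 T ⊆ nb S} ≃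
            {T : Finset (ℤ × ℕ) // (T.card : ℤ) = m - S.card ∧ Tow T ∧ row0 T ⊆ nb S ∧ True} :=
          Equiv.subtypeEquivRight (fun T => by simp)
        exact Finite.of_equiv _ (e.trans (peel m S hI (fun _ => True)).symm)
    exact Finite.of_equiv _ ((toIn m M).trans (split m (ind M))).symm

instance inst_fin (m : ℤ) (M : Finset ℤ) :
    Finite {T : Finset (ℤ × ℕ) // (T.card : ℤ) = m ∧ Tow T ∧ row0 T ⊆ M} :=
  fin (m.toNat + 1) m M (by push_cast; omega)

lemma card_row (m : ℤ) (F : Finset (Finset ℤ)) (hF : ∀ S ∈ F, Ind S) :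
    Nat.card {T : Finset (ℤ × ℕ) // (T.card : ℤ) = m ∧ Tow T ∧ row0 T ∈ F} =
    ∑ S ∈ F, cnt (m - S.card) (nb S) := by
  have e : ∀ S : F, {T : Finset (ℤ × ℕ) // (T.card : ℤ) = m ∧ Tow T ∧ row0 T = S.1 ∧ True} ≃
    {T : Finset (ℤ × ℕ) // (T.card : ℤ) = m - S.1.card ∧ Tow T ∧ row0 T ⊆ nb S.1} := fun S =>
    (peel m S.1 (hF S.1 S.2) (fun _ => True)).trans (Equiv.subtypeEquivRight (fun T => by simp))
  have : ∀ S : F, Finite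
    {T : Finset (ℤ × ℕ) // (T.card : ℤ) = m ∧ Tow T ∧ row0 T = S.1 ∧ True} := fun S =>
    Finite.of_equiv _ (e S).symm
  rw [Nat.card_congr (split m F), Nat.card_sigma, ← Finset.sum_coe_sort F]
  exact Finset.sum_congr rfl fun S _ => Nat.card_congr (e S)

lemma cnt_eq (m : ℤ) (M : Finset ℤ) : cnt m M = ∑ S ∈ ind M, cnt (m - S.card) (nb S) := by
  rw [← card_row m (ind M) (fun S hS => (mem_ind.1 hS).2)]
  exact Nat.card_congr (toIn m M)

lemma cnt_neg {m : ℤ} (hm : m < 0) (M : Finset ℤ) : cnt m M = 0 := by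
  have : IsEmpty {T : Finset (ℤ × ℕ) // (T.card : ℤ) = m ∧ Tow T ∧ row0 T ⊆ M} :=
      ⟨fun T => by have := T.2.1; omega⟩
  exact Nat.card_of_isEmpty

lemma cnt_zero (M : Finset ℤ) : cnt 0 M = 1 := by
  unfold cnt
  rw [Nat.card_eq_one_iff_exists]
  refine ⟨⟨∅, by simp, tow_empty, by simp [row0]⟩, ?_⟩
  rintro ⟨T, h, _⟩
  apply Subtype.ext
  simpa using h

lemma cnt_empty {m : ℤ} (hm : 0 < m) : cnt m ∅ = 0 := by
  have : IsEmpty {T : Finset (ℤ × ℕ) // (T.card : ℤ) = m ∧ Tow T ∧ row0 T ⊆ ∅} :=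
      ⟨fun T => by
        have := T.2.1
        rw [eq_empty_of_row0 T.2.2.1 T.2.2.2] at this
        simp at this; omega⟩
  exact Nat.card_of_isEmpty

lemma nb_insert (q : ℤ) (S : Finset ℤ) : nb (insert q S) = nb S ∪ Finset.Icc (q-1) (q+1) := by
  unfold nb; rw [Finset.biUnion_insert, Finset.union_comm]

lemma sum_with (M : Finset ℤ) (q : ℤ) (hq : q ∈ M) (f : Finset ℤ → ℕ) :
    ∑ S ∈ ind M with q ∈ S, f S =
    ∑ S ∈ ind (M \ Finset.Icc (q-1) (q+1)), f (insert q S) := by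
  symm
  apply Finset.sum_bij (fun S _ => insert q S)
  · intro S hS
    obtain ⟨h1, h2⟩ := mem_ind.1 hS
    rw [Finset.mem_filter, mem_ind]
    have h3 : ∀ x ∈ S, 2 ≤ |x - q| := by
      intro x hx
      have := h1 hx
      rw [Finset.mem_sdiff, Finset.mem_Icc] at this
      rw [le_abs]; omega
    refine ⟨⟨?_, ?_⟩, by simp⟩
    · intro x hx
      rcases Finset.mem_insert.1 hx with rfl | hx
      · exact hq
      · exact (Finset.mem_sdiff.1 (h1 hx)).1
    · intro x hx y hy hxy
      rcases Finset.mem_insert.1 hx with rfl | hx' <;> rcases Finset.mem_insert.1 hy with rfl | hy'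
      · exact absurd rfl hxy
      · rw [abs_sub_comm]; exact h3 y hy'
      · exact h3 x hx'
      · exact h2 x hx' y hy' hxy
  · have key : ∀ S ∈ ind (M \ Finset.Icc (q-1) (q+1)), q ∉ S := by
      intro S hS hqS
      have := (mem_ind.1 hS).1 hqS
      simp at this
    intro S hS S' hS' h
    rw [← Finset.erase_insert (key S hS), ← Finset.erase_insert (key S' hS')]
    exact congrArg (fun X => Finset.erase X q) h
  · intro S hS
    rw [Finset.mem_filter, mem_ind] at hS
    obtain ⟨⟨h1, h2⟩, h3⟩ := hS
    refine ⟨S.erase q, ?_, Finset.insert_erase h3⟩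
    rw [mem_ind]
    constructor
    · intro x hx
      rw [Finset.mem_erase] at hx
      rw [Finset.mem_sdiff, Finset.mem_Icc]
      refine ⟨h1 hx.2, ?_⟩
      have := h2 x hx.2 q h3 hx.1
      rw [le_abs] at this; omega
    · intro x hx y hy
      exact h2 x (Finset.mem_of_mem_erase hx) y (Finset.mem_of_mem_erase hy)
  · intro S hS; rfl

lemma sum_split (M : Finset ℤ) (q : ℤ) (hq : q ∈ M) (f : Finset ℤ → ℕ) :
    ∑ S ∈ ind M, f S = ∑ S ∈ ind (M.erase q), f S +
      ∑ S ∈ ind (M \ Finset.Icc (q-1) (q+1)), f (insert q S) := by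
  rw [← sum_with M q hq, ← Finset.sum_filter_add_sum_filter_not (ind M) (fun S => q ∈ S), add_comm]
  congr 2
  ext S
  rw [Finset.mem_filter, mem_ind, mem_ind, Finset.subset_erase]
  tauto

lemma card_ins {M S : Finset ℤ} {q : ℤ} (hS : S ∈ ind (M \ Finset.Icc (q-1) (q+1))) :
    (insert q S).card = S.card + 1 := by
  apply Finset.card_insert_of_notMem
  intro h
  have := (mem_ind.1 hS).1 h
  simp at this

def Rec (m : ℤ) : Prop := ∀ (M : Finset ℤ) (p : ℤ), p ∈ M →
  cnt m M = cnt m (M.erase p) + cnt (m - 1) (M ∪ Finset.Icc (p-1) (p+1))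

lemma expand (c : ℕ) : ∀ (m : ℤ), (∀ m' ≤ m, Rec m') → ∀ M B : Finset ℤ, M.card = c → Disjoint M B →
    cnt m (M ∪ B) = ∑ S ∈ ind M, cnt (m - S.card) (nb S ∪ B) := by
  induction c using Nat.strong_induction_on with
  | _ c ih =>
    intro m hR M B hc hd
    rcases M.eq_empty_or_nonempty with rfl | ⟨q, hq⟩
    · have : ind ∅ = {∅} := by
        ext S; rw [mem_ind]; simp
        rintro rfl; simp [Ind]
      rw [this]; simp [nb]
    · have hqB : q ∉ B := Finset.disjoint_left.1 hd hq
      rw [sum_split M q hq, hR m le_rfl (M ∪ B) q (by simp [hq])]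
      congr 1
      · rw [Finset.erase_union_distrib, Finset.erase_eq_of_notMem hqB]
        refine ih _ ?_ m hR _ _ rfl (hd.mono_left (Finset.erase_subset _ _))
        rw [← hc]; exact Finset.card_erase_lt_of_mem hq
      · have e : M ∪ B ∪ Finset.Icc (q-1) (q+1) =
            (M \ Finset.Icc (q-1) (q+1)) ∪ (B ∪ Finset.Icc (q-1) (q+1)) := by
          ext x; simp only [Finset.mem_union, Finset.mem_sdiff]; tauto
        rw [e, ih _ ?_ (m - 1) (fun m' h => hR m' (by omega)) _ _ rfl]
        · apply Finset.sum_congr rfl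
          intro S hS
          rw [card_ins hS, nb_insert]
          congr 1
          · push_cast; ring
          · ext x; simp only [Finset.mem_union]; tauto
        · rw [Finset.disjoint_union_right]
          exact ⟨hd.mono_left Finset.sdiff_subset, Finset.sdiff_disjoint⟩
        · rw [← hc]
          apply Finset.card_lt_card
          refine ⟨Finset.sdiff_subset, fun h => ?_⟩
          have := h hq
          simp at this

lemma rec_all (k : ℕ) : ∀ m : ℤ, m < k → Rec m := by
  induction k with
  | zero =>
    intro m hm M p _
    push_cast at hm
    rw [cnt_neg hm, cnt_neg hm, cnt_neg (by omega)]
  | succ k ih =>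
    intro m hm M p hp
    push_cast at hm
    rw [cnt_eq m M, sum_split M p hp, ← cnt_eq]
    congr 1
    have e : M ∪ Finset.Icc (p-1) (p+1) =
        (M \ Finset.Icc (p-1) (p+1)) ∪ Finset.Icc (p-1) (p+1) := by
      ext x; simp only [Finset.mem_union, Finset.mem_sdiff]; tauto
    rw [e, expand _ (m-1) (fun m' h => ih m' (by omega)) _ _ rfl Finset.sdiff_disjoint]
    apply Finset.sum_congr rfl
    intro S hS
    rw [card_ins hS, nb_insert]
    congr 1
    push_cast; ring

lemma rec_holds (m : ℤ) : Rec m := rec_all (m.toNat + 1) m (by push_cast; omega)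

lemma cnt_Icc (m : ℕ) : ∀ (k : ℕ) (a : ℤ),
    cnt m (Finset.Icc a (a + k)) = (2 * m + k - 1).choose m := by
  induction m with
  | zero => intro k a; simp [cnt_zero]
  | succ m ih =>
    intro k
    induction k with
    | zero =>
      intro a
      rw [rec_holds _ _ a (by simp)]
      have e1 : (Finset.Icc a (a + (0:ℕ))).erase a = ∅ := by
        ext x; simp
      have e2 : Finset.Icc a (a + (0:ℕ)) ∪ Finset.Icc (a-1) (a+1) =
          Finset.Icc (a-1) (a - 1 + (2:ℕ)) := by
        ext x; simp only [Finset.mem_union, Finset.mem_Icc]; push_cast; omega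
      rw [e1, e2, cnt_empty (by positivity)]
      have := ih 2 (a - 1)
      push_cast at this ⊢
      rw [add_sub_cancel_right, this, zero_add]
      have : 2 * (m+1) + 0 - 1 = 2 * m + 1 := by omega
      rw [this]
      exact Nat.choose_symm_half m |>.symm
    | succ k ihk =>
      intro a
      rw [rec_holds _ _ a (by simp; omega)]
      have e1 : (Finset.Icc a (a + (k+1:ℕ))).erase a = Finset.Icc (a+1) (a + 1 + k) := by
        ext x; simp only [Finset.mem_erase, Finset.mem_Icc]; push_cast; omega
      have e2 : Finset.Icc a (a + (k+1:ℕ)) ∪ Finset.Icc (a-1) (a+1) =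
          Finset.Icc (a-1) (a - 1 + (k+2:ℕ)) := by
        ext x; simp only [Finset.mem_union, Finset.mem_Icc]; push_cast; omega
      rw [e1, e2, ihk]
      have := ih (k+2) (a - 1)
      have h1 : ((m+1:ℕ):ℤ) - 1 = m := by push_cast; ring
      rw [h1, this]
      have h2 : 2 * (m+1) + k - 1 = 2 * m + k + 1 := by omega
      have h3 : 2 * m + (k+2) - 1 = 2 * m + k + 1 := by omega
      have h4 : 2 * (m+1) + (k+1) - 1 = 2 * m + k + 1 + 1 := by omega
      rw [h2, h3, h4, Nat.choose_succ_succ (2 * m + k + 1) m, add_comm]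

lemma sum_with2 (M : Finset ℤ) (q r : ℤ) (hq : q ∈ M) (hr : r ∈ M \ Finset.Icc (q-1) (q+1))
    (f : Finset ℤ → ℕ) :
    ∑ S ∈ ind M with q ∈ S ∧ r ∈ S, f S =
    ∑ S ∈ ind ((M \ Finset.Icc (q-1) (q+1)) \ Finset.Icc (r-1) (r+1)),
      f (insert q (insert r S)) := by
  have hrq : r ≠ q := by
    rintro rfl
    simp at hr
  rw [← Finset.filter_filter, Finset.sum_filter, sum_with M q hq,
    ← sum_with _ r hr (fun S => f (insert q S)), Finset.sum_filter]
  simp [hrq]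

def base (b : ℕ) : Finset ℤ := (Finset.range b).image (fun i : ℕ => 2 * (i : ℤ))

lemma mem_base {b : ℕ} {x : ℤ} : x ∈ base b ↔ ∃ i : ℕ, i < b ∧ x = 2 * (i : ℤ) := by
  simp [base, eq_comm]

lemma card_base (b : ℕ) : (base b).card = b := by
  unfold base
  rw [Finset.card_image_of_injective, Finset.card_range]
  intro i j h
  dsimp only at h
  omega

lemma ind_base (b : ℕ) : Ind (base b) := by
  intro x hx y hy hxy
  obtain ⟨i, _, rfl⟩ := mem_base.1 hx
  obtain ⟨j, _, rfl⟩ := mem_base.1 hy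
  rw [le_abs]; omega

lemma nb_base {b : ℕ} (hb : 1 ≤ b) : nb (base b) = Finset.Icc (-1) (2 * (b:ℤ) - 1) := by
  ext x
  rw [mem_nb, Finset.mem_Icc]
  constructor
  · rintro ⟨y, hy, h⟩
    obtain ⟨i, _, rfl⟩ := mem_base.1 hy
    rw [abs_le] at h; omega
  · intro h
    by_cases hx : x = -1
    · exact ⟨0, mem_base.2 ⟨0, by omega, by simp⟩, by rw [hx]; simp⟩
    · refine ⟨2 * (x / 2), mem_base.2 ⟨(x/2).toNat, by omega, by omega⟩, ?_⟩
      rw [abs_le]; omega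

end DT

open DT in
theorem domino_tower_count_D (n b : ℕ) (hb : 2 ≤ b) (hbn : b ≤ n) :
    Nat.card {T : Finset (ℤ × ℕ) //
        IsDominoTower n b T ∧ ((-1 : ℤ), 1) ∈ T ∧ ((2 * (b : ℤ) - 1), 1) ∈ T} =
      binom (2 * n - 3) ((n : ℤ) - b - 2) := by
  set q : ℤ := -1 with hq
  set r : ℤ := 2 * (b : ℤ) - 1 with hr
  set F := (ind (nb (base b))).filter (fun S => q ∈ S ∧ r ∈ S) with hF
  have e1 : {T : Finset (ℤ × ℕ) // IsDominoTower n b T ∧ (q, 1) ∈ T ∧ (r, 1) ∈ T} ≃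
      {T : Finset (ℤ × ℕ) // (T.card : ℤ) = n ∧ Tow T ∧ row0 T = base b ∧
        ((q, 0) ∈ up T ∧ (r, 0) ∈ up T)} := by
    refine Equiv.subtypeEquivRight (fun T => ?_)
    have h0 : row0 T = base b ↔ (∀ x : ℤ, (x, 0) ∈ T ↔ ∃ i : ℕ, i < b ∧ x = 2 * (i : ℤ)) := by
      rw [Finset.ext_iff]
      simp only [mem_row0, mem_base]
    rw [h0, mem_up, mem_up]
    unfold IsDominoTower Tow
    rw [Nat.cast_inj]
    tauto
  have e2 : {T : Finset (ℤ × ℕ) // (T.card : ℤ) = n - (base b).card ∧ Tow T ∧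
        row0 T ⊆ nb (base b) ∧ ((q, 0) ∈ T ∧ (r, 0) ∈ T)} ≃
      {T : Finset (ℤ × ℕ) // (T.card : ℤ) = n - b ∧ Tow T ∧ row0 T ∈ F} := by
    refine Equiv.subtypeEquivRight (fun T => ?_)
    rw [card_base, hF, Finset.mem_filter, mem_ind, mem_row0, mem_row0]
    have := @ind_row0 T
    tauto
  rw [Nat.card_congr ((e1.trans
    (peel n (base b) (ind_base b) (fun T => (q, 0) ∈ T ∧ (r, 0) ∈ T))).trans e2),
    card_row _ F (fun S hS => (mem_ind.1 (Finset.mem_filter.1 hS).1).2), hF, nb_base (by omega),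
    sum_with2 _ q r (by rw [Finset.mem_Icc]; omega) (by
      rw [Finset.mem_sdiff, Finset.mem_Icc, Finset.mem_Icc]; omega)]
  set M := (Finset.Icc (-1) (2 * (b:ℤ) - 1) \ Finset.Icc (q-1) (q+1)) \ Finset.Icc (r-1) (r+1)
    with hM
  set B := Finset.Icc (q-1) (q+1) ∪ Finset.Icc (r-1) (r+1) with hB
  have hd : Disjoint M B := by
    rw [Finset.disjoint_left]
    intro x
    simp only [hM, hB, Finset.mem_sdiff, Finset.mem_union]
    tauto
  have hMB : M ∪ B = Finset.Icc (-2 : ℤ) (-2 + ((2 * b + 2 : ℕ) : ℤ)) := by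
    ext x
    simp only [hM, hB, Finset.mem_sdiff, Finset.mem_union, Finset.mem_Icc]
    push_cast
    omega
  have key := expand _ ((n:ℤ) - b - 2) (fun m' _ => rec_holds m') M B rfl hd
  rw [hMB] at key
  have : ∑ S ∈ ind M, cnt ((n:ℤ) - b - (insert q (insert r S)).card) (nb (insert q (insert r S)))
      = cnt ((n:ℤ) - b - 2) (Finset.Icc (-2 : ℤ) (-2 + ((2 * b + 2 : ℕ) : ℤ))) := by
    rw [key]
    apply Finset.sum_congr rfl
    intro S hS
    have hrS := card_ins hS
    have hqS : q ∉ insert r S := by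
      intro h
      rcases Finset.mem_insert.1 h with h | h
      · omega
      · have := (mem_ind.1 hS).1 h
        simp [hM] at this
    rw [Finset.card_insert_of_notMem hqS, hrS, nb_insert, nb_insert]
    congr 1
    · push_cast; ring
    · ext x; simp only [hB, Finset.mem_union]; tauto
  rw [this]
  unfold binom
  split_ifs with h
  · obtain ⟨m, hm⟩ := Int.eq_ofNat_of_zero_le h
    rw [hm, cnt_Icc, Int.toNat_natCast]
    congr 1
    omega
  · exact cnt_neg (by omega) _
end

section
/- For every integer n ≥ 2, the number of (n,1)-domino towers equals three times the number of (n−1,1)-domino towers plus the number of (n−1,2)-domino towers (the latter count being 0 when n−1 < 2). -/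
open Classical in
/-- Shift a tower by `d`, raise it by one level, and put a single domino at the origin below. -/
noncomputable def domLift (d : ℤ) (T : Finset (ℤ × ℕ)) : Finset (ℤ × ℕ) :=
  insert (0, 0) (T.image fun p => (p.1 + d, p.2 + 1))

open Classical in
/-- Remove level 0 and shift back. -/
noncomputable def domDrop (d : ℤ) (S : Finset (ℤ × ℕ)) : Finset (ℤ × ℕ) :=
  (S.filter fun p => 1 ≤ p.2).image fun p => (p.1 - d, p.2 - 1)

theorem mem_domLift_zero (d : ℤ) (T : Finset (ℤ × ℕ)) (x : ℤ) :
    (x, 0) ∈ domLift d T ↔ x = 0 := by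
  simp [domLift]

theorem mem_domLift_succ (d : ℤ) (T : Finset (ℤ × ℕ)) (x : ℤ) (y : ℕ) :
    (x, y + 1) ∈ domLift d T ↔ (x - d, y) ∈ T := by
  simp only [domLift, Finset.mem_insert, Finset.mem_image, Prod.mk.injEq, Prod.exists]
  constructor
  · rintro (h | ⟨a, b, h, h1, h2⟩)
    · omega
    · obtain rfl : a = x - d := by omega
      obtain rfl : b = y := by omega
      exact h
  · intro h
    exact Or.inr ⟨_, _, h, by omega, rfl⟩

theorem mem_domDrop (d : ℤ) (S : Finset (ℤ × ℕ)) (x : ℤ) (y : ℕ) :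
    (x, y) ∈ domDrop d S ↔ (x + d, y + 1) ∈ S := by
  simp only [domDrop, Finset.mem_filter, Finset.mem_image, Prod.mk.injEq, Prod.exists]
  constructor
  · rintro ⟨a, b, ⟨h, h0⟩, h1, h2⟩
    obtain rfl : a = x + d := by omega
    obtain rfl : b = y + 1 := by omega
    exact h
  · intro h
    exact ⟨_, _, ⟨h, by omega⟩, by omega, by omega⟩

theorem card_domLift (d : ℤ) (T : Finset (ℤ × ℕ)) : (domLift d T).card = T.card + 1 := by
  classical
  unfold domLift
  rw [Finset.card_insert_of_notMem (by simp)]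
  congr 1
  convert Finset.card_image_of_injective T (f := fun p : ℤ × ℕ => (p.1 + d, p.2 + 1)) ?_
  rintro ⟨a, b⟩ ⟨a', b'⟩ h
  simpa using h

theorem domLift_domDrop (d : ℤ) (S : Finset (ℤ × ℕ)) (h : ∀ x : ℤ, (x, 0) ∈ S ↔ x = 0) :
    domLift d (domDrop d S) = S := by
  ext ⟨x, y⟩
  cases y with
  | zero => rw [mem_domLift_zero, h]
  | succ y => rw [mem_domLift_succ, mem_domDrop]; simp

theorem isDominoTower_domLift {m b : ℕ} {d : ℤ} {T : Finset (ℤ × ℕ)} (hT : IsDominoTower m b T)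
    (hd : ∀ i : ℕ, i < b → |2 * (i : ℤ) + d| ≤ 1) : IsDominoTower (m + 1) 1 (domLift d T) := by
  obtain ⟨h1, h2, h3, h4⟩ := hT
  refine ⟨by rw [card_domLift, h1], ?_, ?_, ?_⟩
  · intro x
    rw [mem_domLift_zero]
    constructor
    · intro h; exact ⟨0, by omega, by simpa using h⟩
    · rintro ⟨i, hi, h⟩; omega
  · intro x x' y
    cases y with
    | zero => rw [mem_domLift_zero, mem_domLift_zero]; omega
    | succ y =>
      rw [mem_domLift_succ, mem_domLift_succ]
      intro a a' hne
      have := h3 _ _ _ a a' (by omega)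
      simpa using this
  · intro x y
    cases y with
    | zero =>
      rw [mem_domLift_succ, h2]
      rintro ⟨i, hi, h⟩
      refine ⟨0, (mem_domLift_zero _ _ _).2 rfl, ?_⟩
      have := hd i hi
      rw [← h] at this
      simpa using this
    | succ y =>
      rw [mem_domLift_succ]
      intro h
      obtain ⟨x', hx', hh⟩ := h4 _ _ h
      refine ⟨x' + d, by rw [mem_domLift_succ]; simpa using hx', ?_⟩
      rwa [show x - (x' + d) = x - d - x' by ring]

theorem isDominoTower_domDrop {m b : ℕ} {d : ℤ} {S : Finset (ℤ × ℕ)}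
    (hS : IsDominoTower (m + 1) 1 S)
    (hb : ∀ x : ℤ, (x, 1) ∈ S ↔ ∃ i : ℕ, i < b ∧ x - d = 2 * (i : ℤ)) :
    IsDominoTower m b (domDrop d S) ∧ domLift d (domDrop d S) = S := by
  obtain ⟨h1, h2, h3, h4⟩ := hS
  have key : domLift d (domDrop d S) = S := by
    apply domLift_domDrop
    intro x
    rw [h2]
    constructor
    · rintro ⟨i, hi, h⟩; omega
    · intro h; exact ⟨0, by omega, by simpa using h⟩
  refine ⟨⟨?_, ?_, ?_, ?_⟩, key⟩
  · have := card_domLift d (domDrop d S)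
    rw [key] at this; omega
  · intro x
    rw [mem_domDrop, zero_add, hb]; simp
  · intro x x' y
    rw [mem_domDrop, mem_domDrop]
    intro a a' hne
    have := h3 _ _ _ a a' (by omega)
    simpa using this
  · intro x y
    rw [mem_domDrop]
    intro h
    obtain ⟨x', hx', hh⟩ := h4 _ _ h
    refine ⟨x' - d, by rw [mem_domDrop]; simpa using hx', ?_⟩
    rwa [show x - (x' - d) = x + d - x' by ring]

theorem finite_dominoTower (n b : ℕ) : Finite {T : Finset (ℤ × ℕ) // IsDominoTower n b T} := by
  classical
  have : {T : Finset (ℤ × ℕ) | IsDominoTower n b T} ⊆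
      ((Finset.Icc (-(2 * b + n : ℤ)) (2 * b + n) ×ˢ Finset.range n).powerset :
        Finset (Finset (ℤ × ℕ))) := by
    rintro T ⟨h1, h2, h3, h4⟩
    have key : ∀ (y : ℕ) (x : ℤ), (x, y) ∈ T →
        |x| ≤ 2 * b + y ∧ ∀ z ≤ y, ∃ x', (x', z) ∈ T := by
      intro y
      induction y with
      | zero =>
        intro x hx
        refine ⟨?_, ?_⟩
        · obtain ⟨i, hi, h⟩ := (h2 x).1 hx
          rw [abs_le]; omega
        · intro z hz
          obtain rfl : z = 0 := by omega
          exact ⟨x, hx⟩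
      | succ y ih =>
        intro x hx
        obtain ⟨x', hx', hh⟩ := h4 _ _ hx
        obtain ⟨ha, hb⟩ := ih x' hx'
        refine ⟨?_, ?_⟩
        · rw [abs_le] at *
          push_cast
          omega
        · intro z hz
          rcases Nat.lt_or_ge y z with h | h
          · obtain rfl : z = y + 1 := by omega
            exact ⟨x, hx⟩
          · exact hb z h
    rw [Finset.mem_coe, Finset.mem_powerset]
    rintro ⟨x, y⟩ hxy
    obtain ⟨ha, hb⟩ := key y x hxy
    have hy : y + 1 ≤ n := by
      have hsub : Finset.range (y + 1) ⊆ T.image Prod.snd := by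
        intro z hz
        obtain ⟨x', hx'⟩ := hb z (by simpa [Nat.lt_succ_iff] using hz)
        exact Finset.mem_image.2 ⟨_, hx', rfl⟩
      have := (Finset.card_le_card hsub).trans Finset.card_image_le
      simpa [h1] using this
    rw [abs_le] at ha
    rw [Finset.mem_product, Finset.mem_Icc, Finset.mem_range]
    exact ⟨⟨by dsimp only; omega, by dsimp only; omega⟩, hy⟩
  exact (Set.Finite.subset (Finset.finite_toSet _) this).to_subtype

theorem domLift_injective (d : ℤ) {T T' : Finset (ℤ × ℕ)} (h : domLift d T = domLift d T') :
    T = T' := by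
  ext ⟨x, y⟩
  have := mem_domLift_succ d T (x + d) y
  rw [h, mem_domLift_succ] at this
  simpa using this.symm

theorem exists_level_one {m : ℕ} (hm : 1 ≤ m) {S : Finset (ℤ × ℕ)}
    (hS : IsDominoTower (m + 1) 1 S) : ∃ x, (x, 1) ∈ S := by
  by_contra hne
  push Not at hne
  obtain ⟨h1, h2, h3, h4⟩ := hS
  have hno : ∀ (y : ℕ) (x : ℤ), (x, y + 1) ∉ S := by
    intro y
    induction y with
    | zero => exact hne
    | succ y ih =>
      intro x hx
      obtain ⟨x', hx', -⟩ := h4 _ _ hx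
      exact ih _ hx'
  have hsub : S ⊆ {(0, 0)} := by
    rintro ⟨x, y⟩ hxy
    cases y with
    | zero =>
      obtain ⟨i, hi, h⟩ := (h2 x).1 hxy
      obtain rfl : x = 0 := by omega
      simp
    | succ y => exact absurd hxy (hno y x)
  have := Finset.card_le_card hsub
  rw [Finset.card_singleton] at this
  omega

theorem domino_tower_base_one_recurrence (n : ℕ) (hn : 2 ≤ n) :
    Nat.card {T : Finset (ℤ × ℕ) // IsDominoTower n 1 T} =
      3 * Nat.card {T : Finset (ℤ × ℕ) // IsDominoTower (n - 1) 1 T} +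
        Nat.card {T : Finset (ℤ × ℕ) // IsDominoTower (n - 1) 2 T} := by
  obtain ⟨m, rfl⟩ : ∃ m, n = m + 1 := ⟨n - 1, by omega⟩
  rw [Nat.add_sub_cancel]
  have := finite_dominoTower m 1
  have := finite_dominoTower m 2
  have h3 : 3 * Nat.card {T : Finset (ℤ × ℕ) // IsDominoTower m 1 T} =
      Nat.card (Fin 3 × {T : Finset (ℤ × ℕ) // IsDominoTower m 1 T}) := by
    rw [Nat.card_prod, Nat.card_fin]
  rw [h3, ← Nat.card_sum]
  symm
  let f : (Fin 3 × {T : Finset (ℤ × ℕ) // IsDominoTower m 1 T}) ⊕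
      {T : Finset (ℤ × ℕ) // IsDominoTower m 2 T} →
      {T : Finset (ℤ × ℕ) // IsDominoTower (m + 1) 1 T} := fun s =>
    match s with
    | Sum.inl (i, T) => ⟨domLift ((i.val : ℤ) - 1) T.1, isDominoTower_domLift T.2 (by
        intro j hj; rw [abs_le]; omega)⟩
    | Sum.inr T => ⟨domLift (-1) T.1, isDominoTower_domLift T.2 (by
        intro j hj; rw [abs_le]; omega)⟩
  -- base of a lifted tower
  have base : ∀ (b : ℕ) (d : ℤ) (T : Finset (ℤ × ℕ)), IsDominoTower m b T → ∀ x,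
      ((x, 1) ∈ domLift d T ↔ ∃ i : ℕ, i < b ∧ x - d = 2 * (i : ℤ)) := by
    intro b d T hT x
    rw [← hT.2.1]
    exact mem_domLift_succ d T x 0
  have mix : ∀ (i : Fin 3) (T T' : Finset (ℤ × ℕ)), IsDominoTower m 1 T →
      IsDominoTower m 2 T' → domLift ((i.val : ℤ) - 1) T ≠ domLift (-1) T' := by
    intro i T T' hT hT' h
    have a1 := (base 2 (-1) T' hT' 1).2 ⟨1, by omega, by norm_num⟩
    have a2 := (base 2 (-1) T' hT' (-1)).2 ⟨0, by omega, by norm_num⟩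
    rw [← h] at a1 a2
    obtain ⟨j, hj, e⟩ := (base 1 _ T hT _).1 a1
    obtain ⟨k, hk, e'⟩ := (base 1 _ T hT _).1 a2
    omega
  refine Nat.card_eq_of_bijective f ⟨?_, ?_⟩
  · rintro (⟨i, T⟩ | T) (⟨j, T'⟩ | T') h
    · have h' : domLift ((i.val : ℤ) - 1) T.1 = domLift ((j.val : ℤ) - 1) T'.1 :=
        congrArg Subtype.val h
      have a1 := (base 1 ((i.val : ℤ) - 1) T.1 T.2 ((i.val : ℤ) - 1)).2 ⟨0, by omega, by simp⟩
      rw [h'] at a1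
      obtain ⟨k, hk, e⟩ := (base 1 _ T'.1 T'.2 _).1 a1
      obtain rfl : i = j := Fin.ext (by omega)
      rw [Subtype.ext (domLift_injective _ h')]
    · exact absurd (congrArg Subtype.val h) (mix i _ _ T.2 T'.2)
    · exact absurd (congrArg Subtype.val h).symm (mix j _ _ T'.2 T.2)
    · rw [Subtype.ext (domLift_injective _ (congrArg Subtype.val h : domLift (-1) T.1 = domLift (-1) T'.1))]
  · rintro ⟨S, hS⟩
    have near : ∀ x, (x, 1) ∈ S → -1 ≤ x ∧ x ≤ 1 := by
      intro x hx
      obtain ⟨x', hx', hh⟩ := hS.2.2.2 _ _ hx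
      obtain ⟨i, hi, h⟩ := (hS.2.1 x').1 hx'
      rw [abs_le] at hh
      omega
    have apart : ∀ x x', (x, 1) ∈ S → (x', 1) ∈ S → x ≠ x' → x - x' ≤ -2 ∨ 2 ≤ x - x' := by
      intro x x' h h' hne
      have := hS.2.2.1 x x' 1 h h' hne
      rw [le_abs] at this
      omega
    by_cases hboth : ((-1 : ℤ), 1) ∈ S ∧ ((1 : ℤ), 1) ∈ S
    · obtain ⟨ha, hb⟩ := hboth
      obtain ⟨hT, hl⟩ := isDominoTower_domDrop (b := 2) (d := -1) hS (by
        intro x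
        constructor
        · intro hx
          have := near x hx
          by_cases e : x = -1
          · exact ⟨0, by omega, by omega⟩
          · have := apart x (-1) hx ha e
            exact ⟨1, by omega, by omega⟩
        · rintro ⟨i, hi, h⟩
          rcases (by omega : x = -1 ∨ x = 1) with rfl | rfl
          · exact ha
          · exact hb)
      exact ⟨Sum.inr ⟨_, hT⟩, Subtype.ext hl⟩
    · obtain ⟨x₀, hx₀⟩ := exists_level_one (by omega) hS
      have hr := near x₀ hx₀
      have hd : (((x₀ + 1).toNat : ℤ)) - 1 = x₀ := by omega
      obtain ⟨hT, hl⟩ := isDominoTower_domDrop (b := 1) (d := x₀) hS (by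
        intro x
        constructor
        · intro hx
          have h1 := near x hx
          by_cases e : x = x₀
          · exact ⟨0, by omega, by omega⟩
          · exfalso
            have h2 := apart x x₀ hx hx₀ e
            apply hboth
            rcases (by omega : (x = -1 ∧ x₀ = 1) ∨ (x = 1 ∧ x₀ = -1)) with ⟨rfl, rfl⟩ | ⟨rfl, rfl⟩
            · exact ⟨hx, hx₀⟩
            · exact ⟨hx₀, hx⟩
        · rintro ⟨i, hi, h⟩
          obtain rfl : x = x₀ := by omega
          exact hx₀)
      refine ⟨Sum.inl (⟨(x₀ + 1).toNat, by omega⟩, ⟨_, hT⟩), Subtype.ext ?_⟩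
      change domLift ((((x₀ + 1).toNat : ℕ) : ℤ) - 1) (domDrop x₀ S) = S
      rw [hd, hl]
end
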